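/- arXiv:quant-ph/9802049 — 4 statements merged into one kernel-verified Lean document; each statement's English description precedes it below -/
import Mathlib

section
/- Let p : ℝ → ℝ be a polynomial such that b_1 ≤ p(i) ≤ b_2 for every integer i with 0 ≤ i ≤ N, and |p'(x)| ≥ c for some real x with 0 ≤ x ≤ N, where c > 0. Then deg(p) ≥ sqrt(cN/(c + b_2 − b_1)). -/
open Polynomial in
/-- The angle-addition formula for `cos`, pushed through a polynomial `P` of degree at most `n`. -/
theorem Polynomial.exists_eval_cos_add (θ : ℝ) (n : ℕ) (P : ℝ[X]) (hP : P.natDegree ≤ n) :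
    ∃ A B : ℝ[X], (∀ m, n < m → A.coeff m = 0) ∧ (∀ m, n ≤ m → B.coeff m = 0) ∧
      (∀ t : ℝ, P.eval (Real.cos (θ + t)) =
        A.eval (Real.cos t) + Real.sin t * B.eval (Real.cos t)) ∧
      A.eval 1 = P.eval (Real.cos θ) ∧
      B.eval 1 = -(Real.sin θ * (derivative P).eval (Real.cos θ)) := by
  induction n generalizing P with
  | zero =>
    obtain ⟨a, rfl⟩ := natDegree_eq_zero.mp (Nat.le_zero.mp hP)
    refine ⟨C a, 0, fun m hm => ?_, by simp, by simp, by simp, by simp⟩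
    simp [coeff_C, hm.ne']
  | succ n ih =>
    obtain ⟨A, B, hA, hB, hAB, hA1, hB1⟩ := ih P.divX (by
      rw [natDegree_divX_eq_natDegree_tsub_one]
      omega)
    have hdP : derivative P = P.divX + X * derivative P.divX := by
      conv_lhs => rw [← X_mul_divX_add P]
      rw [derivative_add, derivative_mul, derivative_X, derivative_C, one_mul, add_zero]
    have hev (x : ℝ) : P.eval x = x * P.divX.eval x + P.coeff 0 := by
      conv_lhs => rw [← X_mul_divX_add P]
      rw [eval_add, eval_mul, eval_X, eval_C]
    refine ⟨C (P.coeff 0) + C (Real.cos θ) * (X * A) - C (Real.sin θ) * (B - X * (X * B)),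
      C (Real.cos θ) * (X * B) - C (Real.sin θ) * A, fun m hm => ?_, fun m hm => ?_,
      fun t => ?_, ?_, ?_⟩
    · obtain ⟨m, rfl⟩ : ∃ k, m = k + 2 := ⟨m - 2, by omega⟩
      simp [coeff_X_mul, hA (m + 1) (by omega), hB (m + 2) (by omega), hB m (by omega)]
    · obtain ⟨m, rfl⟩ : ∃ k, m = k + 1 := ⟨m - 1, by omega⟩
      simp [coeff_X_mul, hA (m + 1) (by omega), hB m (by omega)]
    · rw [hev, hAB t, Real.cos_add]
      simp only [eval_add, eval_sub, eval_mul, eval_C, eval_X]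
      linear_combination (-(Real.sin θ * B.eval (Real.cos t))) * Real.sin_sq_add_cos_sq t
    · rw [hev, ← hA1]
      simp
      ring
    · rw [hdP]
      simp only [eval_add, eval_sub, eval_mul, eval_C, eval_X]
      rw [← hA1, hB1]
      ring

open Polynomial Polynomial.Chebyshev in
/-- The Chebyshev polynomial `T n` is its leading coefficient times the nodal polynomial of its
roots. -/
theorem Polynomial.Chebyshev.T_real_eq_C_mul_nodal (n : ℕ) :
    T ℝ n = Polynomial.C (2 ^ (n - 1)) *
      Lagrange.nodal (Finset.range n) (fun k : ℕ => Real.cos ((2 * k + 1) * Real.pi / (2 * n))) := by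
  have hinj := Multiset.inj_on_of_nodup_map (roots_T_real_nodup n)
  have hroots := roots_T_real n
  rw [Finset.image_val_of_injOn (by simpa [Set.InjOn] using hinj)] at hroots
  have hcard : (T ℝ n).roots.card = (T ℝ n).natDegree := by
    rw [hroots]; simp
  have h := C_leadingCoeff_mul_prod_multiset_X_sub_C hcard
  rw [hroots, leadingCoeff_T] at h
  rw [Lagrange.nodal_eq, ← h]
  simp [Multiset.map_map, Finset.prod]

open Polynomial Polynomial.Chebyshev in
theorem Polynomial.Chebyshev.abs_derivative_T_real_mul_sin_root {n : ℕ} (hn : n ≠ 0) (k : ℕ) :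
    |(derivative (T ℝ n)).eval (Real.cos ((2 * k + 1) * Real.pi / (2 * n)))| *
      |Real.sin ((2 * k + 1) * Real.pi / (2 * n))| = n := by
  rw [T_derivative_eq_U, ← abs_mul, eval_mul, mul_assoc, U_real_cos]
  have h : (((n : ℤ) - 1 : ℤ) + 1 : ℝ) * ((2 * k + 1) * Real.pi / (2 * n)) =
      k * Real.pi + Real.pi / 2 := by
    push_cast
    field_simp
    ring
  rw [h, Real.sin_add_pi_div_two, Real.cos_nat_mul_pi]
  simp [abs_mul]

open Polynomial Polynomial.Chebyshev in
/-- Schur's inequality to the right of the largest root of `T n`. -/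
theorem Polynomial.abs_eval_le_of_cos_lt {n : ℕ} (hn : n ≠ 0) {R : ℝ[X]} (hR : R.degree < n)
    (hbnd : ∀ θ : ℝ, |R.eval (Real.cos θ)| * |Real.sin θ| ≤ 1) {x : ℝ}
    (hx : Real.cos (Real.pi / (2 * n)) < x) (hx1 : x ≤ 1) : |R.eval x| ≤ n := by
  have hn0 : (0 : ℝ) < n := by positivity
  set v : ℕ → ℝ := fun k => Real.cos ((2 * k + 1) * Real.pi / (2 * n)) with hv
  have hinj : Set.InjOn v (Finset.range n) := by
    have := Multiset.inj_on_of_nodup_map (roots_T_real_nodup n)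
    simpa [Set.InjOn] using this
  have hvx : ∀ k ∈ Finset.range n, v k < x := by
    intro k hk
    refine lt_of_le_of_lt (Real.cos_le_cos_of_nonneg_of_le_pi (by positivity) ?_ ?_) hx
    · rw [div_le_iff₀ (by positivity)]
      have : (k : ℝ) + 1 ≤ n := by exact_mod_cast Finset.mem_range.mp hk
      nlinarith [Real.pi_pos]
    · gcongr
      nlinarith [Real.pi_pos, (Nat.cast_nonneg k : (0 : ℝ) ≤ k)]
  have hT := T_real_eq_C_mul_nodal n
  rw [← hv] at hT
  set ω := Lagrange.nodal (Finset.range n) v with hω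
  have hRx : R.eval x = ω.eval x *
      ∑ i ∈ Finset.range n, Lagrange.nodalWeight (Finset.range n) v i * (x - v i)⁻¹ *
        R.eval (v i) := by
    conv_lhs => rw [Lagrange.eq_interpolate hinj (f := R) (by simpa using hR)]
    exact Lagrange.eval_interpolate_not_at_node _ fun i hi => (hvx i hi).ne'
  have hωx : 0 < ω.eval x := by
    rw [hω, Lagrange.eval_nodal]
    exact Finset.prod_pos fun i hi => sub_pos.mpr (hvx i hi)
  have hdω : (derivative ω).eval x = ω.eval x * ∑ i ∈ Finset.range n, (x - v i)⁻¹ := by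
    rw [hω, Lagrange.derivative_nodal, eval_finsetSum, Finset.mul_sum]
    refine Finset.sum_congr rfl fun i hi => ?_
    rw [Lagrange.nodal_eq_mul_nodal_erase hi]
    have := (sub_pos.mpr (hvx i hi)).ne'
    simp only [eval_mul, eval_sub, eval_X, eval_C]
    field_simp
  have hdT (y : ℝ) : (derivative (T ℝ n)).eval y = 2 ^ (n - 1) * (derivative ω).eval y := by
    rw [hT, derivative_C_mul, eval_mul, eval_C]
  have hterm : ∀ i ∈ Finset.range n, |Lagrange.nodalWeight (Finset.range n) v i * (x - v i)⁻¹ *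
      R.eval (v i)| ≤ 2 ^ (n - 1) / n * (x - v i)⁻¹ := by
    intro i hi
    have hpos := sub_pos.mpr (hvx i hi)
    rw [Lagrange.nodalWeight_eq_eval_derivative_nodal hi, ← hω, abs_mul, abs_mul, abs_inv,
      abs_of_pos (inv_pos.mpr hpos)]
    have h1 := abs_derivative_T_real_mul_sin_root hn i
    have h2 := hbnd ((2 * i + 1) * Real.pi / (2 * n))
    rw [hdT, abs_mul, abs_of_pos (by positivity : (0 : ℝ) < 2 ^ (n - 1))] at h1
    change 2 ^ (n - 1) * |(derivative ω).eval (v i)| * _ = _ at h1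
    change |R.eval (v i)| * _ ≤ _ at h2
    set s := |Real.sin ((2 * i + 1) * Real.pi / (2 * n))|
    have hs : 0 < s := lt_of_le_of_ne (abs_nonneg _) fun h => by
      rw [← h, mul_zero] at h1
      exact hn0.ne h1
    have hd : 0 < |(derivative ω).eval (v i)| := lt_of_le_of_ne (abs_nonneg _) fun h => by
      rw [← h, mul_zero, zero_mul] at h1
      exact hn0.ne h1
    have key : |(derivative ω).eval (v i)|⁻¹ * |R.eval (v i)| ≤ 2 ^ (n - 1) / n := by
      rw [inv_mul_eq_div, div_le_div_iff₀ hd hn0, ← h1]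
      calc |R.eval (v i)| * (2 ^ (n - 1) * |(derivative ω).eval (v i)| * s)
          = (|R.eval (v i)| * s) * (2 ^ (n - 1) * |(derivative ω).eval (v i)|) := by ring
        _ ≤ 1 * (2 ^ (n - 1) * |(derivative ω).eval (v i)|) := by gcongr
        _ = _ := by ring
    calc _ = |(derivative ω).eval (v i)|⁻¹ * |R.eval (v i)| * (x - v i)⁻¹ := by ring
      _ ≤ _ := by gcongr
  have hTx : (derivative (T ℝ n)).eval x ≤ (n : ℝ) ^ 2 := by
    have hx0 : -1 ≤ x := (Real.neg_one_le_cos _).trans hx.le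
    have h := abs_iterate_derivative_T_real_le n 1 (abs_le.mpr ⟨hx0, hx1⟩)
    simp only [Function.iterate_one, derivative_T_eval_one] at h
    exact_mod_cast (le_abs_self _).trans h
  calc |R.eval x| ≤ ω.eval x * ∑ i ∈ Finset.range n, 2 ^ (n - 1) / n * (x - v i)⁻¹ := by
        rw [hRx, abs_mul, abs_of_pos hωx]
        gcongr
        exact (Finset.abs_sum_le_sum_abs _ _).trans (Finset.sum_le_sum hterm)
    _ = (derivative (T ℝ n)).eval x / n := by
        rw [hdT, hdω, ← Finset.mul_sum]
        ring
    _ ≤ n := by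
        rw [div_le_iff₀ hn0]
        linarith [hTx, sq (n : ℝ)]

open Polynomial in
/-- **Schur's inequality**: a real polynomial `R` of degree less than `n` with
`|R y| √(1 - y²) ≤ 1` on `[-1, 1]` is bounded by `n` there. -/
theorem Polynomial.abs_eval_le_of_abs_mul_sin_le_one {n : ℕ} {R : ℝ[X]} (hR : R.degree < n)
    (hbnd : ∀ θ : ℝ, |R.eval (Real.cos θ)| * |Real.sin θ| ≤ 1) {x : ℝ}
    (hx : x ∈ Set.Icc (-1 : ℝ) 1) : |R.eval x| ≤ n := by
  rcases eq_or_ne n 0 with rfl | hn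
  · have : R = 0 := by simpa [Nat.WithBot.lt_zero_iff] using hR
    simp [this]
  have hn0 : (0 : ℝ) < n := by positivity
  rcases lt_or_ge (Real.cos (Real.pi / (2 * n))) x with h | h
  · exact abs_eval_le_of_cos_lt hn hR hbnd h hx.2
  rcases lt_or_ge (Real.cos (Real.pi / (2 * n))) (-x) with h' | h'
  · have hdeg : (R.comp (-X)).degree < n := by
      rwa [degree_comp_neg_X]
    have := abs_eval_le_of_cos_lt hn hdeg (fun θ => by
      have := hbnd (Real.pi - θ)
      simpa using this) h' (by linarith [hx.1])
    simpa using this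
  · have h1 : 1 ≤ n * Real.sin (Real.pi / (2 * n)) := by
      have hle : Real.pi / (2 * n) ≤ Real.pi / 2 := by
        have : (1 : ℝ) ≤ n := by exact_mod_cast Nat.one_le_iff_ne_zero.mpr hn
        gcongr
        linarith
      have := Real.mul_le_sin (x := Real.pi / (2 * n)) (by positivity) hle
      have h2 : 2 / Real.pi * (Real.pi / (2 * n)) = 1 / n := by field_simp
      rw [h2, div_le_iff₀ hn0] at this
      linarith
    have h2 : Real.sin (Real.pi / (2 * n)) ≤ |Real.sin (Real.arccos x)| := by
      refine (le_abs_self _).trans (sq_le_sq.mp ?_)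
      rw [Real.sin_sq, Real.sin_sq, Real.cos_arccos hx.1 hx.2]
      nlinarith
    have h3 := hbnd (Real.arccos x)
    rw [Real.cos_arccos hx.1 hx.2] at h3
    calc |R.eval x| ≤ |R.eval x| * (n * |Real.sin (Real.arccos x)|) :=
          le_mul_of_one_le_right (abs_nonneg _) (h1.trans (by gcongr))
      _ = n * (|R.eval x| * |Real.sin (Real.arccos x)|) := by ring
      _ ≤ n * 1 := by gcongr
      _ = n := mul_one _

open Polynomial in
/-- **Bernstein's inequality** for algebraic polynomials on `[-1, 1]`. -/
theorem Polynomial.abs_eval_derivative_mul_sin_le {n : ℕ} {P : ℝ[X]} (hP : P.natDegree ≤ n)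
    (hbnd : ∀ y ∈ Set.Icc (-1 : ℝ) 1, |P.eval y| ≤ 1) (θ : ℝ) :
    |(derivative P).eval (Real.cos θ)| * |Real.sin θ| ≤ n := by
  obtain ⟨A, B, -, hB, hAB, -, hB1⟩ := exists_eval_cos_add θ n P hP
  have hBn := abs_eval_le_of_abs_mul_sin_le_one (degree_lt_iff_coeff_zero B n |>.mpr hB)
    (fun t => by
      have h1 := abs_le.mp (hbnd _ (Real.cos_mem_Icc (θ + t)))
      have h2 := abs_le.mp (hbnd _ (Real.cos_mem_Icc (θ + -t)))
      rw [hAB] at h1 h2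
      rw [Real.cos_neg, Real.sin_neg] at h2
      rw [← abs_mul, abs_le]
      constructor <;> linarith) (x := 1) (by norm_num)
  rw [hB1, abs_neg, abs_mul] at hBn
  linarith

open Polynomial in
/-- **Markov's inequality** on `[-1, 1]`. -/
theorem Polynomial.abs_eval_derivative_le_sq {n : ℕ} {P : ℝ[X]} (hP : P.natDegree ≤ n)
    (hbnd : ∀ y ∈ Set.Icc (-1 : ℝ) 1, |P.eval y| ≤ 1) {x : ℝ} (hx : x ∈ Set.Icc (-1 : ℝ) 1) :
    |(derivative P).eval x| ≤ n ^ 2 := by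
  rcases eq_or_ne n 0 with rfl | hn
  · simp [derivative_of_natDegree_zero (Nat.le_zero.mp hP)]
  have hn0 : (0 : ℝ) < n := by positivity
  have hdeg : (C (n : ℝ)⁻¹ * derivative P).degree < n := by
    rw [degree_C_mul (inv_ne_zero hn0.ne')]
    rcases eq_or_ne P 0 with rfl | hP0
    · simp
    · exact (degree_derivative_lt hP0).trans_le (natDegree_le_iff_degree_le.mp hP)
  have h := abs_eval_le_of_abs_mul_sin_le_one hdeg (fun θ => by
    rw [eval_mul, eval_C, abs_mul, abs_of_pos (inv_pos.mpr hn0), mul_assoc, inv_mul_le_iff₀ hn0,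
      mul_one]
    exact abs_eval_derivative_mul_sin_le hP hbnd θ) hx
  rw [eval_mul, eval_C, abs_mul, abs_of_pos (inv_pos.mpr hn0), inv_mul_le_iff₀ hn0] at h
  rwa [sq]

open Polynomial in
/-- **Markov's inequality** on `[0, L]`, for a polynomial staying within `h` of `m`. -/
theorem Polynomial.abs_eval_derivative_mul_le {p : ℝ[X]} {L m h : ℝ} (hL : 0 < L) (hh : 0 < h)
    (hbnd : ∀ y ∈ Set.Icc 0 L, |p.eval y - m| ≤ h) {x : ℝ} (hx : x ∈ Set.Icc 0 L) :
    |(derivative p).eval x| * L ≤ 2 * h * p.natDegree ^ 2 := by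
  set q : ℝ[X] := C (L / 2) * X + C (L / 2) with hq
  set P : ℝ[X] := C h⁻¹ * (p.comp q - C m) with hPdef
  have hqdeg : q.natDegree ≤ 1 := natDegree_linear_le
  have hPdeg : P.natDegree ≤ p.natDegree := by
    refine (natDegree_C_mul_le _ _).trans ?_
    rw [natDegree_sub_C]
    exact natDegree_comp_le.trans (by nlinarith)
  have hPb : ∀ y ∈ Set.Icc (-1 : ℝ) 1, |P.eval y| ≤ 1 := by
    intro y hy
    have := hbnd (L / 2 * y + L / 2) ⟨by nlinarith [hy.1], by nlinarith [hy.2]⟩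
    simp only [hPdef, hq, eval_mul, eval_sub, eval_comp, eval_add, eval_C, eval_X]
    rwa [abs_mul, abs_of_pos (inv_pos.mpr hh), inv_mul_le_iff₀ hh, mul_one]
  have hx' : 2 * x / L - 1 ∈ Set.Icc (-1 : ℝ) 1 := by
    have h1 : 0 ≤ 2 * x / L := div_nonneg (by linarith [hx.1]) hL.le
    have h2 : 2 * x / L ≤ 2 := by rw [div_le_iff₀ hL]; linarith [hx.2]
    constructor <;> linarith
  have hM := abs_eval_derivative_le_sq hPdeg hPb hx'
  have hd : (derivative P).eval (2 * x / L - 1) = h⁻¹ * (L / 2 * (derivative p).eval x) := by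
    have hqx : q.eval (2 * x / L - 1) = x := by
      simp only [hq, eval_add, eval_mul, eval_C, eval_X]
      field_simp
      ring
    have hdq : derivative q = C (L / 2) := by simp [hq]
    rw [hPdef, derivative_C_mul, derivative_sub, derivative_C, sub_zero, derivative_comp, hdq,
      eval_mul, eval_mul, eval_C, eval_C, eval_comp, hqx]
  rw [hd, abs_mul, abs_mul, abs_of_pos (inv_pos.mpr hh), abs_of_pos (half_pos hL),
    inv_mul_le_iff₀ hh] at hM
  linarith

/-- Ehlich–Zeller / Rivlin–Cheney: if a real polynomial `p` satisfies
`b₁ ≤ p(i) ≤ b₂` at every integer `0 ≤ i ≤ N` and `|p'(x)| ≥ c > 0` for some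
real `0 ≤ x ≤ N`, then `deg p ≥ √(cN/(c + b₂ − b₁))`. -/
theorem ehlich_zeller_rivlin_cheney (N : ℕ) (p : Polynomial ℝ) (b₁ b₂ c : ℝ)
    (hc : 0 < c)
    (hbound : ∀ i : ℕ, i ≤ N → b₁ ≤ p.eval (i : ℝ) ∧ p.eval (i : ℝ) ≤ b₂)
    (hderiv : ∃ x : ℝ, 0 ≤ x ∧ x ≤ (N : ℝ) ∧ c ≤ |(Polynomial.derivative p).eval x|) :
    Real.sqrt (c * N / (c + b₂ - b₁)) ≤ p.natDegree := by
  rcases Nat.eq_zero_or_pos N with rfl | hN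
  · simp
  have hN0 : (0 : ℝ) < N := by exact_mod_cast hN
  have hb : b₁ ≤ b₂ := (hbound 0 (Nat.zero_le _)).1.trans (hbound 0 (Nat.zero_le _)).2
  obtain ⟨x, hx0, hxN, hcx⟩ := hderiv
  obtain ⟨z, hz, hmax⟩ := (isCompact_Icc (a := (0 : ℝ)) (b := N)).exists_isMaxOn ⟨x, hx0, hxN⟩
    (Polynomial.continuous (Polynomial.derivative p)).abs.continuousOn
  rw [isMaxOn_iff] at hmax
  set M := |(Polynomial.derivative p).eval z| with hMdef
  have hcM : c ≤ M := hcx.trans (hmax x ⟨hx0, hxN⟩)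
  have hnear : ∀ y ∈ Set.Icc (0 : ℝ) N,
      |p.eval y - (b₁ + b₂) / 2| ≤ (b₂ - b₁ + M) / 2 := by
    intro y hy
    have hfl : ⌊y + 1 / 2⌋₊ ≤ N := by
      have h := Nat.floor_le_floor (show y + 1 / 2 ≤ (N : ℝ) + 1 / 2 by linarith [hy.2])
      refine h.trans (Nat.lt_succ_iff.mp ((Nat.floor_lt (by positivity)).mpr ?_))
      push_cast
      linarith
    set k := ⌊y + 1 / 2⌋₊ with hk
    have h1 : (k : ℝ) ≤ y + 1 / 2 := Nat.floor_le (by linarith [hy.1])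
    have h2 : y + 1 / 2 < k + 1 := Nat.lt_floor_add_one _
    have hky : |y - k| ≤ 1 / 2 := by rw [abs_le]; constructor <;> linarith
    have hmv := (convex_Icc (0 : ℝ) N).norm_image_sub_le_of_norm_deriv_le
      (f := fun t => p.eval t) (C := M) (fun t _ => p.differentiableAt)
      (fun t ht => by simpa using hmax t ht)
      (⟨Nat.cast_nonneg k, by exact_mod_cast hfl⟩ : (k : ℝ) ∈ Set.Icc (0 : ℝ) N) hy
    rw [Real.norm_eq_abs, Real.norm_eq_abs] at hmv
    have h3 : |p.eval y - p.eval (k : ℝ)| ≤ M * (1 / 2) := hmv.trans (by gcongr)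
    have h4 := abs_le.mp h3
    have h5 := hbound k hfl
    rw [abs_le]
    constructor <;> linarith
  have hmarkov := Polynomial.abs_eval_derivative_mul_le hN0 (by linarith) hnear hz
  rw [← hMdef] at hmarkov
  refine Real.sqrt_le_left (Nat.cast_nonneg _) |>.mpr ?_
  rw [div_le_iff₀ (by linarith)]
  have hM0 : 0 < M := hc.trans_le hcM
  refine le_of_mul_le_mul_left ?_ hM0
  calc M * (c * N) = c * (M * N) := by ring
    _ ≤ c * (2 * ((b₂ - b₁ + M) / 2) * p.natDegree ^ 2) := by gcongr
    _ = (c * M + c * (b₂ - b₁)) * p.natDegree ^ 2 := by ring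
    _ ≤ (c * M + M * (b₂ - b₁)) * p.natDegree ^ 2 := by
        gcongr
    _ = M * (p.natDegree ^ 2 * (c + b₂ - b₁)) := by ring
end

section
/- For every Boolean function f : {0,1}^N → {0,1}, the block sensitivity of f satisfies bs(f) ≤ 6 · adeg(f)^2, where adeg(f) is the approximate degree of f. -/
noncomputable def bR (b : Bool) : ℝ := if b then 1 else 0

/-- `X` with the bits in `B` flipped. -/
def flipB {N : ℕ} (X : Fin N → Bool) (B : Finset (Fin N)) : Fin N → Bool :=
  fun i => if i ∈ B then !(X i) else X i

open Polynomial in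
/-- Markov's inequality at the left endpoint of `[0, 1]`. -/
theorem abs_eval_derivative_zero_le {Q : ℝ[X]} {d : ℕ} (hd : Q.natDegree ≤ d) {c M : ℝ}
    (hM : 0 < M) (hQ : ∀ μ ∈ Set.Icc (0 : ℝ) 1, |Q.eval μ - c| ≤ M) :
    |Q.derivative.eval 0| ≤ 2 * M * (d : ℝ) ^ 2 := by
  have key : ∀ a : ℝ, |a| = M⁻¹ → a * Q.derivative.eval 0 ≤ 2 * (d : ℝ) ^ 2 := by
    intro a ha
    have hdeg : (C (-a) * (Q.comp (C (1 / 2) - C (1 / 2) * X) - C c)).degree ≤ (d : ℕ) := by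
      refine degree_le_of_natDegree_le ((natDegree_C_mul_le _ _).trans ?_)
      rw [natDegree_sub_C]
      refine natDegree_comp_le.trans ?_
      have h1 : (C (1 / 2 : ℝ) - C (1 / 2) * X).natDegree ≤ 1 := by compute_degree
      calc _ ≤ d * 1 := Nat.mul_le_mul hd h1
        _ = d := mul_one d
    have h := Chebyshev.eval_iterate_derivative_le_of_forall_abs_le_one (k := 1) le_rfl hdeg (by
      intro x hx
      have h2 := hQ (1 / 2 - 1 / 2 * x) ⟨by linarith [hx.2], by linarith [hx.1]⟩
      simp only [eval_mul, eval_C, eval_sub, eval_comp, eval_X, abs_mul, abs_neg, ha]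
      calc _ ≤ M⁻¹ * M := by gcongr
        _ = 1 := inv_mul_cancel₀ hM.ne')
    simp [Chebyshev.derivative_T_eval_one, derivative_comp] at h
    linarith
  have h1 := key M⁻¹ (abs_of_pos (inv_pos.mpr hM))
  have h2 := key (-M⁻¹) (by rw [abs_neg, abs_of_pos (inv_pos.mpr hM)])
  rw [neg_mul, neg_le] at h2
  rw [abs_le]
  constructor
  · have := mul_le_mul_of_nonneg_left h2 hM.le
    rw [mul_inv_cancel_left₀ hM.ne'] at this
    linarith
  · have := mul_le_mul_of_nonneg_left h1 hM.le
    rw [mul_inv_cancel_left₀ hM.ne'] at this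
    linarith

section SetFunction

variable {α : Type*} [DecidableEq α]

/-- The indicator of the sets containing `A`. -/
def supersetIndicator (A : Finset α) : Finset α → ℝ := fun S => if A ⊆ S then 1 else 0

theorem supersetIndicator_mul (A B : Finset α) :
    supersetIndicator A * supersetIndicator B = supersetIndicator (A ∪ B) := by
  ext S
  simp only [supersetIndicator, Pi.mul_apply, Finset.union_subset_iff]
  split_ifs <;> simp_all

theorem supersetIndicator_empty : supersetIndicator (∅ : Finset α) = 1 := by
  ext S
  simp [supersetIndicator]

/-- The set functions that are multilinear polynomials of degree at most `d` in the
membership indicators. -/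
def setFunctionsOfDegreeLE (α : Type*) [DecidableEq α] (d : ℕ) :
    Submodule ℝ (Finset α → ℝ) :=
  Submodule.span ℝ {g | ∃ A : Finset α, A.card ≤ d ∧ supersetIndicator A = g}

theorem supersetIndicator_mem {A : Finset α} {d : ℕ} (h : A.card ≤ d) :
    supersetIndicator A ∈ setFunctionsOfDegreeLE α d :=
  Submodule.subset_span ⟨A, h, rfl⟩

theorem one_mem_setFunctionsOfDegreeLE (d : ℕ) :
    (1 : Finset α → ℝ) ∈ setFunctionsOfDegreeLE α d := by
  rw [← supersetIndicator_empty]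
  exact supersetIndicator_mem (by simp)

theorem setFunctionsOfDegreeLE_mono {d e : ℕ} (h : d ≤ e) :
    setFunctionsOfDegreeLE α d ≤ setFunctionsOfDegreeLE α e := by
  refine Submodule.span_mono ?_
  rintro _ ⟨A, hA, rfl⟩
  exact ⟨A, hA.trans h, rfl⟩

theorem mul_mem_setFunctionsOfDegreeLE {d e : ℕ} {g h : Finset α → ℝ}
    (hg : g ∈ setFunctionsOfDegreeLE α d) (hh : h ∈ setFunctionsOfDegreeLE α e) :
    g * h ∈ setFunctionsOfDegreeLE α (d + e) := by
  have := Submodule.mul_mem_mul hg hh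
  rw [setFunctionsOfDegreeLE, setFunctionsOfDegreeLE, Submodule.span_mul_span] at this
  refine Submodule.span_mono ?_ this
  rintro _ ⟨_, ⟨A, hA, rfl⟩, _, ⟨B, hB, rfl⟩, rfl⟩
  exact ⟨A ∪ B, (Finset.card_union_le A B).trans (add_le_add hA hB),
    (supersetIndicator_mul A B).symm⟩

theorem pow_mem_setFunctionsOfDegreeLE {g : Finset α → ℝ}
    (hg : g ∈ setFunctionsOfDegreeLE α 1) (k : ℕ) :
    g ^ k ∈ setFunctionsOfDegreeLE α k := by
  induction k with
  | zero => exact one_mem_setFunctionsOfDegreeLE 0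
  | succ k ih => exact mul_mem_setFunctionsOfDegreeLE ih hg

theorem prod_mem_setFunctionsOfDegreeLE {ι : Type*} (s : Finset ι) {g : ι → Finset α → ℝ}
    {e : ι → ℕ} (hg : ∀ i, g i ∈ setFunctionsOfDegreeLE α (e i)) :
    ∏ i ∈ s, g i ∈ setFunctionsOfDegreeLE α (∑ i ∈ s, e i) := by
  classical
  induction s using Finset.induction_on with
  | empty => exact one_mem_setFunctionsOfDegreeLE 0
  | insert i s hi ih =>
    rw [Finset.prod_insert hi, Finset.sum_insert hi]
    exact mul_mem_setFunctionsOfDegreeLE (hg i) ih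

theorem eval_mem_setFunctionsOfDegreeLE {σ : Type*} (p : MvPolynomial σ ℝ)
    {x : σ → Finset α → ℝ} (hx : ∀ i, x i ∈ setFunctionsOfDegreeLE α 1) :
    (fun S => MvPolynomial.eval (fun i => x i S) p) ∈
      setFunctionsOfDegreeLE α p.totalDegree := by
  have : (fun S => MvPolynomial.eval (fun i => x i S) p) =
      ∑ m ∈ p.support, p.coeff m • ∏ i ∈ m.support, x i ^ m i := by
    ext S
    simp [MvPolynomial.eval_eq]
  rw [this]
  refine Submodule.sum_mem _ fun m hm => Submodule.smul_mem _ _ ?_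
  exact setFunctionsOfDegreeLE_mono (MvPolynomial.le_totalDegree hm)
    (prod_mem_setFunctionsOfDegreeLE _ fun i => pow_mem_setFunctionsOfDegreeLE (hx i) (m i))

variable [Fintype α]

theorem sum_weight_mul_supersetIndicator (A : Finset α) (μ : ℝ) :
    ∑ S : Finset α, μ ^ S.card * (1 - μ) ^ Sᶜ.card * supersetIndicator A S = μ ^ A.card := by
  have h := Finset.prod_add (fun _ : α => μ) (fun i => if i ∈ A then 0 else 1 - μ) Finset.univ
  rw [Finset.powerset_univ] at h
  trans ∏ i : α, (μ + if i ∈ A then 0 else 1 - μ)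
  · rw [h]
    refine Finset.sum_congr rfl fun S _ => ?_
    rw [Finset.prod_const, mul_assoc, ← Finset.compl_eq_univ_sdiff]
    congr 1
    unfold supersetIndicator
    split_ifs with hA
    · rw [mul_one, ← Finset.prod_const]
      refine Finset.prod_congr rfl fun i hi => ?_
      rw [if_neg fun h => Finset.mem_compl.mp hi (hA h)]
    · obtain ⟨i, hi, hiS⟩ := Finset.not_subset.mp hA
      rw [mul_zero]
      symm
      apply Finset.prod_eq_zero (Finset.mem_compl.mpr hiS)
      rw [if_pos hi]
  · have : ∀ i, (μ + if i ∈ A then 0 else 1 - μ) = if i ∈ A then μ else 1 := by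
      intro i
      split_ifs <;> ring
    simp [this, Finset.prod_ite_mem]

open Polynomial in
/-- The expectation of a set function of degree at most `d` under the `μ`-biased product
measure is a polynomial in `μ` of degree at most `d`. -/
theorem exists_polynomial_eval_eq_sum_weight {d : ℕ} {g : Finset α → ℝ}
    (hg : g ∈ setFunctionsOfDegreeLE α d) :
    ∃ Q : ℝ[X], Q.natDegree ≤ d ∧
      (∀ μ, Q.eval μ = ∑ S : Finset α, μ ^ S.card * (1 - μ) ^ Sᶜ.card * g S) ∧
      Q.derivative.eval 0 = ∑ i, (g {i} - g ∅) := by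
  induction hg using Submodule.span_induction with
  | mem g hg =>
    obtain ⟨A, hA, rfl⟩ := hg
    refine ⟨X ^ A.card, by simpa using hA, fun μ => ?_, ?_⟩
    · rw [sum_weight_mul_supersetIndicator, eval_pow, eval_X]
    · rcases A.eq_empty_or_nonempty with rfl | hne
      · simp [supersetIndicator]
      · have h0 : supersetIndicator A ∅ = 0 := by
          simp [supersetIndicator, hne.ne_empty]
        simp only [h0, sub_zero]
        simp only [supersetIndicator, Finset.subset_singleton_iff, hne.ne_empty,
          false_or]
        by_cases h1 : A.card = 1
        · obtain ⟨j, rfl⟩ := Finset.card_eq_one.mp h1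
          simp
        · have : ∀ i, A ≠ {i} := fun i hi => h1 (by simp [hi])
          have hpos := hne.card_pos
          simp only [this, if_false, Finset.sum_const_zero, derivative_X_pow, eval_mul, eval_pow,
            eval_X]
          rw [zero_pow (by omega), mul_zero]
  | zero => exact ⟨0, by simp, by simp, by simp⟩
  | add g h _ _ ihg ihh =>
    obtain ⟨P, hPd, hP, hP'⟩ := ihg
    obtain ⟨Q, hQd, hQ, hQ'⟩ := ihh
    refine ⟨P + Q, natDegree_add_le_of_degree_le hPd hQd, fun μ => ?_, ?_⟩
    · simp [hP, hQ, mul_add, Finset.sum_add_distrib]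
    · simp only [derivative_add, eval_add, hP', hQ', ← Finset.sum_add_distrib, Pi.add_apply]
      exact Finset.sum_congr rfl fun i _ => by ring
  | smul a g _ ih =>
    obtain ⟨P, hPd, hP, hP'⟩ := ih
    refine ⟨a • P, (natDegree_smul_le a P).trans hPd, fun μ => ?_, ?_⟩
    · simp only [eval_smul, hP, smul_eq_mul, Finset.mul_sum, Pi.smul_apply]
      exact Finset.sum_congr rfl fun S _ => by ring
    · simp only [derivative_smul, eval_smul, hP', smul_eq_mul, Finset.mul_sum, Pi.smul_apply,
        mul_sub]

/-- A bounded set function of degree `d` has total influence at `∅` at most quadratic in `d`. -/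
theorem abs_sum_singleton_sub_empty_le {d : ℕ} {g : Finset α → ℝ}
    (hg : g ∈ setFunctionsOfDegreeLE α d) {c M : ℝ} (hM : 0 < M) (hb : ∀ S, |g S - c| ≤ M) :
    |∑ i, (g {i} - g ∅)| ≤ 2 * M * (d : ℝ) ^ 2 := by
  obtain ⟨Q, hQd, hQ, hQ'⟩ := exists_polynomial_eval_eq_sum_weight hg
  rw [← hQ']
  refine abs_eval_derivative_zero_le hQd hM (c := c) fun μ hμ => ?_
  have hw : ∑ S : Finset α, μ ^ S.card * (1 - μ) ^ Sᶜ.card = 1 := by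
    simpa [supersetIndicator_empty] using sum_weight_mul_supersetIndicator (∅ : Finset α) μ
  have hμ0 : 0 ≤ μ := hμ.1
  have hμ1 : 0 ≤ 1 - μ := sub_nonneg.mpr hμ.2
  calc |Q.eval μ - c|
      = |∑ S : Finset α, μ ^ S.card * (1 - μ) ^ Sᶜ.card * (g S - c)| := by
        simp only [mul_sub, Finset.sum_sub_distrib, ← Finset.sum_mul, hw, one_mul, hQ]
    _ ≤ ∑ S : Finset α, μ ^ S.card * (1 - μ) ^ Sᶜ.card * M := by
        refine (Finset.abs_sum_le_sum_abs _ _).trans (Finset.sum_le_sum fun S _ => ?_)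
        rw [abs_mul, abs_of_nonneg (by positivity)]
        exact mul_le_mul_of_nonneg_left (hb S) (by positivity)
    _ = M := by rw [← Finset.sum_mul, hw, one_mul]

end SetFunction

theorem bR_flipB_biUnion_mem {N t : ℕ} (X : Fin N → Bool) (B : Fin t → Finset (Fin N))
    (hdisj : ∀ i j : Fin t, i ≠ j → Disjoint (B i) (B j)) (k : Fin N) :
    (fun S : Finset (Fin t) => bR (flipB X (S.biUnion B) k)) ∈
      setFunctionsOfDegreeLE (Fin t) 1 := by
  by_cases h : ∃ j, k ∈ B j
  · obtain ⟨j, hj⟩ := h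
    have hiff : ∀ S : Finset (Fin t), k ∈ S.biUnion B ↔ {j} ⊆ S := by
      intro S
      rw [Finset.mem_biUnion, Finset.singleton_subset_iff]
      refine ⟨?_, fun hS => ⟨j, hS, hj⟩⟩
      rintro ⟨i, hi, hk⟩
      by_contra hS
      exact Finset.disjoint_left.mp (hdisj i j fun e => hS (e ▸ hi)) hk hj
    have : (fun S : Finset (Fin t) => bR (flipB X (S.biUnion B) k)) =
        bR (X k) • 1 + (1 - 2 * bR (X k)) • supersetIndicator {j} := by
      ext S
      simp only [flipB, hiff, supersetIndicator, Pi.add_apply, Pi.smul_apply, Pi.one_apply,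
        smul_eq_mul]
      split_ifs <;> cases X k <;> norm_num [bR]
    rw [this]
    exact Submodule.add_mem _ (Submodule.smul_mem _ _ (one_mem_setFunctionsOfDegreeLE 1))
      (Submodule.smul_mem _ _ (supersetIndicator_mem (by simp)))
  · have : (fun S : Finset (Fin t) => bR (flipB X (S.biUnion B) k)) = bR (X k) • 1 := by
      ext S
      have : k ∉ S.biUnion B := fun hk => by
        obtain ⟨i, -, hi⟩ := Finset.mem_biUnion.mp hk
        exact h ⟨i, hi⟩
      simp [flipB, this]
    rw [this]
    exact Submodule.smul_mem _ _ (one_mem_setFunctionsOfDegreeLE 1)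

/-- Nisan–Szegedy: `bs(f) ≤ 6 · adeg(f)²`.  Stated as: for every polynomial `p`
approximating `f` to within `1/3` on Boolean inputs, and every family of `t`
pairwise disjoint blocks to each of which `f` is sensitive on some input `X`,
we have `t ≤ 6 · (deg p)²`. -/
theorem block_sensitivity_le_approx_degree_sq (N : ℕ)
    (f : (Fin N → Bool) → Bool) (p : MvPolynomial (Fin N) ℝ)
    (happrox : ∀ X : Fin N → Bool,
      |MvPolynomial.eval (fun i => bR (X i)) p - bR (f X)| ≤ 1 / 3)
    (X : Fin N → Bool) (t : ℕ) (B : Fin t → Finset (Fin N))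
    (hdisj : ∀ i j : Fin t, i ≠ j → Disjoint (B i) (B j))
    (hsens : ∀ i : Fin t, f (flipB X (B i)) ≠ f X) :
    t ≤ 6 * p.totalDegree ^ 2 := by
  let g : Finset (Fin t) → ℝ := fun S =>
    MvPolynomial.eval (fun i => bR (flipB X (S.biUnion B) i)) p
  have hg : g ∈ setFunctionsOfDegreeLE (Fin t) p.totalDegree :=
    eval_mem_setFunctionsOfDegreeLE p (bR_flipB_biUnion_mem X B hdisj)
  have hb : ∀ S, |g S - 1 / 2| ≤ 5 / 6 := by
    intro S
    have h := abs_le.mp (happrox (flipB X (S.biUnion B)))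
    rw [abs_le]
    change _ ≤ g S - _ ∧ g S - _ ≤ _ at h
    cases hf : f (flipB X (S.biUnion B)) <;> simp only [hf, bR] at h <;> norm_num at h <;>
      constructor <;> linarith
  have key := abs_le.mp (abs_sum_singleton_sub_empty_le hg (by norm_num) hb)
  have h0 := abs_le.mp (happrox X)
  have hg0 : g ∅ = MvPolynomial.eval (fun i => bR (X i)) p := by simp [g, flipB]
  rw [← hg0] at h0
  have h1 : ∀ i, |g {i} - bR (f (flipB X (B i)))| ≤ 1 / 3 := fun i => by
    simpa only [g, Finset.singleton_biUnion] using happrox (flipB X (B i))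
  have hbound : (t : ℝ) ≤ 6 * (p.totalDegree : ℝ) ^ 2 := by
    have hd : (0 : ℝ) ≤ (p.totalDegree : ℝ) ^ 2 := by positivity
    cases hf : f X
    · have : ∑ _i : Fin t, (1 / 3 : ℝ) ≤ ∑ i, (g {i} - g ∅) := by
        refine Finset.sum_le_sum fun i _ => ?_
        have hi := abs_le.mp (h1 i)
        have hs : f (flipB X (B i)) = true := by simpa [hf] using hsens i
        simp only [hs, hf, bR] at hi h0
        norm_num at hi h0
        linarith
      simp only [Finset.sum_const, Finset.card_univ, Fintype.card_fin, nsmul_eq_mul] at this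
      linarith [key.2]
    · have : ∑ i, (g {i} - g ∅) ≤ ∑ _i : Fin t, (-(1 / 3) : ℝ) := by
        refine Finset.sum_le_sum fun i _ => ?_
        have hi := abs_le.mp (h1 i)
        have hs : f (flipB X (B i)) = false := by simpa [hf] using hsens i
        simp only [hs, hf, bR] at hi h0
        norm_num at hi h0
        linarith
      simp only [Finset.sum_const, Finset.card_univ, Fintype.card_fin, nsmul_eq_mul] at this
      linarith [key.1]
  exact_mod_cast hbound
end

section
/- For every Boolean function f : {0,1}^N → {0,1}, the deterministic decision tree complexity satisfies D(f) ≤ 216 · adeg(f)^6, where adeg(f) is the approximate degree of f. In particular adeg(f) ≤ D(f). -/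
inductive DTree (N : ℕ) where
  | leaf : Bool → DTree N
  | node : Fin N → DTree N → DTree N → DTree N

def DTree.evalT {N : ℕ} : DTree N → (Fin N → Bool) → Bool
  | leaf b, _ => b
  | node i t₀ t₁, X => if X i then (t₁.evalT X) else (t₀.evalT X)

def DTree.depth {N : ℕ} : DTree N → ℕ
  | leaf _ => 0
  | node _ t₀ t₁ => 1 + max t₀.depth t₁.depth

open Polynomial in
theorem Polynomial.eval_derivative_zero_le_of_forall_abs_sub_le {q : ℝ[X]} {c r : ℝ} (hr : 0 < r)
    (hq : ∀ u ∈ Set.Icc (0 : ℝ) 1, |q.eval u - c| ≤ r) :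
    -(q.derivative.eval 0) ≤ 2 * r * (q.natDegree : ℝ) ^ 2 := by
  set n := q.natDegree
  set P : ℝ[X] := C r⁻¹ * (q.comp (C (1 / 2) * (1 - X)) - C c) with hP
  have hdeg : P.degree ≤ n := by
    refine degree_le_of_natDegree_le ((natDegree_C_mul_le _ _).trans ?_)
    refine (natDegree_sub_le _ _).trans (max_le ?_ (by simp))
    refine natDegree_comp_le.trans ?_
    have : (C (1 / 2 : ℝ) * (1 - X)).natDegree ≤ 1 := by compute_degree
    simpa using Nat.mul_le_mul_left n this
  have hbnd : ∀ y ∈ Set.Icc (-1 : ℝ) 1, |P.eval y| ≤ 1 := by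
    intro y hy
    have := hq (1 / 2 * (1 - y)) ⟨by linarith [hy.2], by linarith [hy.1]⟩
    simp only [hP, eval_mul, eval_C, eval_sub, eval_comp, eval_one, eval_X, abs_mul, abs_inv,
      abs_of_pos hr]
    rw [inv_mul_le_iff₀ hr]
    simpa using this
  have key := Chebyshev.eval_iterate_derivative_le_of_forall_abs_le_one (k := 1) le_rfl hdeg hbnd
  simp [Chebyshev.T_derivative_eq_U, Chebyshev.U_eval_one, hP, derivative_comp] at key
  have hscale := mul_le_mul_of_nonneg_left key (mul_pos two_pos hr).le
  have hcancel : 2 * r * -(r⁻¹ * (2⁻¹ * q.derivative.eval 0)) = -q.derivative.eval 0 := by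
    field_simp
  rwa [hcancel, ← pow_two] at hscale

theorem bR_true : bR true = 1 := rfl

theorem bR_false : bR false = 0 := rfl

/-- The input `X` with the bits in the block `B` negated. -/
def flipBlock {ι : Type*} [DecidableEq ι] (X : ι → Bool) (B : Finset ι) : ι → Bool :=
  fun i => if i ∈ B then !X i else X i

@[simp]
theorem flipBlock_empty {ι : Type*} [DecidableEq ι] (X : ι → Bool) : flipBlock X ∅ = X := by
  ext i; simp [flipBlock]

/-- The expectation of `v A` for the random `A ⊆ F` containing each element independently with
probability `u`, as a polynomial in `u`. -/
noncomputable def bernoulliMean {α : Type*} [DecidableEq α] (F : Finset α) (v : Finset α → ℝ) :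
    Polynomial ℝ :=
  ∑ A ∈ F.powerset, Polynomial.X ^ A.card * (1 - Polynomial.X) ^ (F \ A).card * Polynomial.C (v A)

section BernoulliMean

open Polynomial

variable {α : Type*} [DecidableEq α] (F : Finset α)

theorem bernoulliMean_sum {ι : Type*} (s : Finset ι) (c : ι → ℝ) (v : ι → Finset α → ℝ) :
    bernoulliMean F (fun A => ∑ i ∈ s, c i * v i A) =
      ∑ i ∈ s, C (c i) * bernoulliMean F (v i) := by
  simp only [bernoulliMean, map_sum, Finset.mul_sum]
  rw [Finset.sum_comm]
  refine Finset.sum_congr rfl fun i _ => Finset.sum_congr rfl fun A _ => ?_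
  rw [C_mul]; ring

theorem bernoulliMean_prod (a c : α → ℝ) :
    bernoulliMean F (fun A => (∏ B ∈ A, a B) * ∏ B ∈ F \ A, c B) =
      ∏ B ∈ F, (X * C (a B) + (1 - X) * C (c B)) := by
  rw [Finset.prod_add, bernoulliMean]
  refine Finset.sum_congr rfl fun A _ => ?_
  simp only [Finset.prod_mul_distrib, Finset.prod_const, map_mul, map_prod]
  ring

theorem abs_eval_bernoulliMean_sub_le {v : Finset α → ℝ} {c r u : ℝ} (hu : u ∈ Set.Icc (0 : ℝ) 1)
    (hv : ∀ A ⊆ F, |v A - c| ≤ r) : |(bernoulliMean F v).eval u - c| ≤ r := by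
  have hw : ∑ A ∈ F.powerset, u ^ A.card * (1 - u) ^ (F \ A).card = 1 := by
    have := Finset.prod_add (fun _ : α => u) (fun _ => 1 - u) F
    simpa using this.symm
  have h0 : 0 ≤ 1 - u := by linarith [hu.2]
  have h1 : (bernoulliMean F v).eval u - c =
      ∑ A ∈ F.powerset, u ^ A.card * (1 - u) ^ (F \ A).card * (v A - c) := by
    simp only [bernoulliMean, eval_finsetSum, mul_sub, Finset.sum_sub_distrib, ← Finset.sum_mul,
      hw]
    simp
  rw [h1]
  calc _ ≤ ∑ A ∈ F.powerset, u ^ A.card * (1 - u) ^ (F \ A).card * r := by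
        refine (Finset.abs_sum_le_sum_abs _ _).trans (Finset.sum_le_sum fun A hA => ?_)
        have hnn : 0 ≤ u ^ A.card * (1 - u) ^ (F \ A).card :=
          mul_nonneg (pow_nonneg hu.1 _) (pow_nonneg h0 _)
        rw [abs_mul, abs_of_nonneg hnn]
        exact mul_le_mul_of_nonneg_left (hv A (Finset.mem_powerset.1 hA)) hnn
    _ = r := by rw [← Finset.sum_mul, hw, one_mul]

theorem eval_zero_derivative_bernoulliMean (v : Finset α → ℝ) :
    (bernoulliMean F v).derivative.eval 0 = ∑ B ∈ F, (v {B} - v ∅) := by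
  have hterm : ∀ A ∈ F.powerset,
      (X ^ A.card * (1 - X) ^ (F \ A).card * C (v A) : ℝ[X]).derivative.eval 0 =
        (if A.card = 1 then v A else 0) - if A = ∅ then F.card * v ∅ else 0 := by
    intro A _
    rcases hA : A.card with _ | _ | k
    · obtain rfl := Finset.card_eq_zero.1 hA
      simp [derivative_pow]
    · have : A ≠ ∅ := by rintro rfl; simp at hA
      simp [derivative_pow, this]
    · have : A ≠ ∅ := by rintro rfl; simp at hA
      simp [derivative_pow, this]
  rw [bernoulliMean, derivative_sum, eval_finsetSum, Finset.sum_congr rfl hterm,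
    Finset.sum_sub_distrib, ← Finset.sum_filter, ← Finset.powersetCard_eq_filter,
    Finset.powersetCard_one]
  simp

end BernoulliMean

section BlockSensitivity

variable {ι : Type*} [DecidableEq ι]

theorem natDegree_bernoulliMean_monomial_le (X : ι → Bool) {F : Finset (Finset ι)}
    (hF : (F : Set (Finset ι)).PairwiseDisjoint id) (e : ι →₀ ℕ) :
    (bernoulliMean F fun A => ∏ i ∈ e.support, bR (flipBlock X (A.biUnion id) i) ^ e i).natDegree ≤
      e.support.card := by
  set a : Finset ι → ℝ := fun B => ∏ i ∈ e.support ∩ B, bR (!X i) ^ e i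
  set c : Finset ι → ℝ := fun B => ∏ i ∈ e.support ∩ B, bR (X i) ^ e i
  set γ : ℝ := ∏ i ∈ e.support \ F.biUnion id, bR (X i) ^ e i
  have hdisj : (F : Set (Finset ι)).PairwiseDisjoint fun B => e.support ∩ B := fun B hB B' hB' h =>
    (hF hB hB' h).mono Finset.inter_subset_right Finset.inter_subset_right
  have hsplit : ∀ A ∈ F.powerset, ∏ i ∈ e.support, bR (flipBlock X (A.biUnion id) i) ^ e i =
      γ * ((∏ B ∈ A, a B) * ∏ B ∈ F \ A, c B) := by
    intro A hA
    rw [Finset.mem_powerset] at hA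
    have hin : e.support ∩ F.biUnion id = F.biUnion fun B => e.support ∩ B := by
      ext i; simp only [Finset.mem_inter, Finset.mem_biUnion, id]; tauto
    rw [← Finset.prod_sdiff (Finset.inter_subset_left (s₁ := e.support) (s₂ := F.biUnion id)),
      Finset.sdiff_inter_self_left, hin, Finset.prod_biUnion hdisj, ← Finset.prod_sdiff hA,
      mul_comm (∏ B ∈ A, a B)]
    congr 1
    · refine Finset.prod_congr rfl fun i hi => ?_
      have : i ∉ A.biUnion id := fun h =>
        (Finset.mem_sdiff.1 hi).2 (Finset.biUnion_subset_biUnion_of_subset_left _ hA h)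
      simp only [flipBlock, if_neg this]
    · congr 1
      · refine Finset.prod_congr rfl fun B hB => Finset.prod_congr rfl fun i hi => ?_
        have : i ∉ A.biUnion id := by
          intro h
          obtain ⟨B', hB', hi'⟩ := Finset.mem_biUnion.1 h
          obtain ⟨hBF, hBA⟩ := Finset.mem_sdiff.1 hB
          have hne : B ≠ B' := by rintro rfl; exact hBA hB'
          exact Finset.disjoint_left.1 (hF hBF (hA hB') hne) (Finset.mem_inter.1 hi).2 hi'
        simp only [flipBlock, if_neg this]
      · refine Finset.prod_congr rfl fun B hB => Finset.prod_congr rfl fun i hi => ?_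
        have : i ∈ A.biUnion id := Finset.mem_biUnion.2 ⟨B, hB, (Finset.mem_inter.1 hi).2⟩
        simp only [flipBlock, if_pos this]
  have heq : (bernoulliMean F fun A =>
      ∏ i ∈ e.support, bR (flipBlock X (A.biUnion id) i) ^ e i) =
      Polynomial.C γ * ∏ B ∈ F, (Polynomial.X * Polynomial.C (a B) +
        (1 - Polynomial.X) * Polynomial.C (c B)) := by
    rw [← bernoulliMean_prod, bernoulliMean, bernoulliMean, Finset.mul_sum]
    refine Finset.sum_congr rfl fun A hA => ?_
    rw [hsplit A hA, Polynomial.C_mul]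
    ring
  rw [heq]
  refine (Polynomial.natDegree_C_mul_le _ _).trans ((Polynomial.natDegree_prod_le _ _).trans ?_)
  calc _ ≤ ∑ B ∈ F, (e.support ∩ B).card := by
        refine Finset.sum_le_sum fun B _ => ?_
        rcases Nat.eq_zero_or_pos (e.support ∩ B).card with h | h
        · simp [a, c, Finset.card_eq_zero.1 h]
        · refine le_trans ?_ h
          compute_degree
    _ = (F.biUnion fun B => e.support ∩ B).card := (Finset.card_biUnion hdisj).symm
    _ ≤ e.support.card := Finset.card_le_card (by simp)

theorem natDegree_bernoulliMean_eval_le (p : MvPolynomial ι ℝ) (X : ι → Bool)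
    {F : Finset (Finset ι)} (hF : (F : Set (Finset ι)).PairwiseDisjoint id) :
    (bernoulliMean F fun A =>
      p.eval fun i => bR (flipBlock X (A.biUnion id) i)).natDegree ≤ p.totalDegree := by
  simp only [MvPolynomial.eval_eq]
  rw [bernoulliMean_sum]
  refine Polynomial.natDegree_sum_le_of_forall_le _ _ fun e he =>
    (Polynomial.natDegree_C_mul_le _ _).trans
      ((natDegree_bernoulliMean_monomial_le X hF e).trans ?_)
  refine le_trans ?_ (MvPolynomial.le_totalDegree he)
  rw [Finset.card_eq_sum_ones]
  exact Finset.sum_le_sum fun i hi => Nat.one_le_iff_ne_zero.2 (Finsupp.mem_support_iff.1 hi)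

/-- Every family of disjoint sensitive blocks of `f`, at any input, has at most `K` members. -/
def BlockSensitivityLE (f : (ι → Bool) → Bool) (K : ℕ) : Prop :=
  ∀ (X : ι → Bool) (F : Finset (Finset ι)), (F : Set (Finset ι)).PairwiseDisjoint id →
    (∀ B ∈ F, f (flipBlock X B) ≠ f X) → F.card ≤ K

theorem blockSensitivityLE_of_approx {f : (ι → Bool) → Bool} {p : MvPolynomial ι ℝ}
    (hp : ∀ X : ι → Bool, |p.eval (fun i => bR (X i)) - bR (f X)| ≤ 1 / 3) :
    BlockSensitivityLE f (5 * p.totalDegree ^ 2) := by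
  intro X F hF hsens
  wlog hX : f X = true generalizing f p
  · have := this (f := fun Y => !f Y) (p := 1 - p) (fun Y => ?_) (by simpa using hsens)
      (by simpa using hX)
    · refine this.trans ?_
      gcongr
      simpa using MvPolynomial.totalDegree_sub (1 : MvPolynomial ι ℝ) p
    · have := hp Y
      rw [abs_le] at this ⊢
      cases h : f Y <;> simp [h, bR] at this ⊢ <;> constructor <;> linarith
  set v : Finset (Finset ι) → ℝ := fun A => p.eval fun i => bR (flipBlock X (A.biUnion id) i)
  have hv : ∀ A ⊆ F, |v A - 1 / 2| ≤ 5 / 6 := by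
    intro A _
    have := hp (flipBlock X (A.biUnion id))
    rw [abs_le] at this ⊢
    cases h : f (flipBlock X (A.biUnion id)) <;> simp only [h, bR_true, bR_false] at this <;>
      norm_num at this <;> constructor <;> linarith
  have hmarkov := Polynomial.eval_derivative_zero_le_of_forall_abs_sub_le (by norm_num)
    fun u hu => abs_eval_bernoulliMean_sub_le F hu hv
  rw [eval_zero_derivative_bernoulliMean] at hmarkov
  have hdrop : ∑ B ∈ F, (v {B} - v ∅) ≤ ∑ B ∈ F, (-(1 / 3) : ℝ) := by
    refine Finset.sum_le_sum fun B hB => ?_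
    have hB' : f (flipBlock X B) = false := by simpa [hX] using hsens B hB
    have h1 := hp (flipBlock X B)
    have h0 := hp X
    rw [abs_le] at h0 h1
    simp only [hB', hX, bR_true, bR_false] at h0 h1
    norm_num at h0 h1
    simp only [v, Finset.singleton_biUnion, Finset.biUnion_empty, flipBlock_empty, id]
    linarith
  have hdeg : ((bernoulliMean F v).natDegree : ℝ) ≤ p.totalDegree :=
    mod_cast natDegree_bernoulliMean_eval_le p X hF
  have hsq := pow_le_pow_left₀ (Nat.cast_nonneg _) hdeg 2
  simp only [Finset.sum_const, nsmul_eq_mul] at hdrop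
  have : (F.card : ℝ) ≤ 5 * (p.totalDegree : ℝ) ^ 2 := by linarith
  exact_mod_cast this

theorem BlockSensitivityLE.card_le_of_minimal {f : (ι → Bool) → Bool} {K : ℕ}
    (hf : BlockSensitivityLE f K) {X : ι → Bool} {B : Finset ι}
    (hB : Minimal (fun B => f (flipBlock X B) ≠ f X) B) : B.card ≤ K := by
  rw [← Finset.card_image_of_injective B Finset.singleton_injective]
  refine hf (flipBlock X B) _ ?_ ?_
  · intro S hS S' hS' hne
    obtain ⟨i, -, rfl⟩ := Finset.mem_image.1 hS
    obtain ⟨j, -, rfl⟩ := Finset.mem_image.1 hS'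
    exact Finset.disjoint_singleton.2 fun h => hne (by rw [h])
  · intro S hS
    obtain ⟨i, hi, rfl⟩ := Finset.mem_image.1 hS
    have herase : flipBlock (flipBlock X B) {i} = flipBlock X (B.erase i) := by
      ext j
      by_cases hj : j = i
      · subst hj; simp [flipBlock, hi]
      · simp [flipBlock, hj]
    have hnot := hB.not_prop_of_lt (Finset.erase_ssubset hi)
    rw [not_not] at hnot
    rw [herase, hnot]
    exact hB.prop.symm

theorem flipBlock_filter_ne (X Y : ι → Bool) (C : Finset ι) {i : ι} (hi : i ∈ C) :
    flipBlock X {i ∈ C | Y i ≠ X i} i = Y i := by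
  simp only [flipBlock, Finset.mem_filter, hi, true_and]
  cases X i <;> cases Y i <;> simp

theorem BlockSensitivityLE.exists_certificate [Fintype ι] {f : (ι → Bool) → Bool} {K : ℕ}
    (hf : BlockSensitivityLE f K) (X : ι → Bool) :
    ∃ C : Finset ι, C.card ≤ K * K ∧ ∀ Y, (∀ i ∈ C, Y i = X i) → f Y = f X := by
  set sens : Finset ι → Prop := fun B => f (flipBlock X B) ≠ f X
  set good : Finset (Finset ι) → Prop := fun F =>
    (F : Set (Finset ι)).PairwiseDisjoint id ∧ ∀ B ∈ F, Minimal sens B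
  obtain ⟨F, -, hF⟩ := Set.Finite.exists_le_maximal (s := {F | good F}) (Set.toFinite _)
    (a := ∅) (by simp [good])
  obtain ⟨hdisj, hmin⟩ := hF.prop
  refine ⟨F.biUnion id, ?_, fun Y hY => ?_⟩
  · refine (Finset.card_biUnion_le_card_mul _ _ K fun B hB =>
      hf.card_le_of_minimal (hmin B hB)).trans ?_
    exact Nat.mul_le_mul_right K (hf X F hdisj fun B hB => (hmin B hB).prop)
  by_contra hne
  have hflip : flipBlock X {i | Y i ≠ X i} = Y :=
    funext fun i => flipBlock_filter_ne X Y Finset.univ (Finset.mem_univ i)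
  obtain ⟨B, hBsub, hB⟩ := Set.Finite.exists_le_minimal (s := {B | sens B}) (Set.toFinite _)
    (a := ({i | Y i ≠ X i} : Finset ι)) (by simpa [sens, hflip] using hne)
  have hBdisj : ∀ B' ∈ F, Disjoint B B' := fun B' hB' =>
    Finset.disjoint_left.2 fun i hi hi' =>
      (Finset.mem_filter.1 (hBsub hi)).2 (hY i (Finset.mem_biUnion.2 ⟨B', hB', hi'⟩))
  have hgood : good (insert B F) := by
    refine ⟨?_, fun B' hB' => ?_⟩
    · rw [Finset.coe_insert]
      exact hdisj.insert fun B' hB' _ => hBdisj B' hB'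
    · obtain rfl | h := Finset.mem_insert.1 hB'
      · exact hB
      · exact hmin B' h
  have hBF : B ∈ F := hF.le_of_ge hgood (Finset.subset_insert B F) (Finset.mem_insert_self B F)
  have hempty : B = ∅ := disjoint_self.1 (hBdisj B hBF)
  exact hB.prop (by simp [hempty])

end BlockSensitivity

namespace DTree

variable {N : ℕ}

/-- Some decision tree of depth at most `D` computes `f` on the inputs in `P`. -/
def Solvable (f : (Fin N → Bool) → Bool) (D : ℕ) (P : Set (Fin N → Bool)) : Prop :=
  ∃ T : DTree N, T.depth ≤ D ∧ ∀ Y ∈ P, T.evalT Y = f Y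

variable {f : (Fin N → Bool) → Bool}

theorem Solvable.mono {D : ℕ} {P Q : Set (Fin N → Bool)} (h : Solvable f D Q) (hPQ : P ⊆ Q) :
    Solvable f D P :=
  let ⟨T, hT, hTf⟩ := h
  ⟨T, hT, fun Y hY => hTf Y (hPQ hY)⟩

theorem solvable_of_forall_eq {P : Set (Fin N → Bool)} (D : ℕ) (b : Bool)
    (h : ∀ Y ∈ P, f Y = b) : Solvable f D P :=
  ⟨leaf b, Nat.zero_le _, fun Y hY => (h Y hY).symm⟩

theorem Solvable.query (D : ℕ) (C : Finset (Fin N)) (P : Set (Fin N → Bool))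
    (h : ∀ ρ : Fin N → Bool, Solvable f D {Y ∈ P | ∀ i ∈ C, Y i = ρ i}) :
    Solvable f (C.card + D) P := by
  induction C using Finset.induction_on generalizing P with
  | empty => simpa using h fun _ => false
  | insert a C ha ih =>
    have hb (b : Bool) : Solvable f (C.card + D) {Y ∈ P | Y a = b} := by
      refine ih _ fun ρ => (h (Function.update ρ a b)).mono ?_
      rintro Y ⟨⟨hYP, hYa⟩, hYC⟩
      refine ⟨hYP, fun i hi => ?_⟩
      obtain rfl | hi := Finset.mem_insert.1 hi
      · simpa using hYa
      · rw [Function.update_of_ne (ne_of_mem_of_not_mem hi ha), hYC i hi]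
    obtain ⟨T₀, hT₀, hf₀⟩ := hb false
    obtain ⟨T₁, hT₁, hf₁⟩ := hb true
    refine ⟨node a T₀ T₁, ?_, fun Y hY => ?_⟩
    · rw [Finset.card_insert_of_notMem ha, depth]
      have := max_le hT₀ hT₁
      omega
    · cases hYa : Y a
      · simpa [evalT, hYa] using hf₀ Y ⟨hY, hYa⟩
      · simpa [evalT, hYa] using hf₁ Y ⟨hY, hYa⟩

theorem solvable_of_blocks {K M : ℕ} (hf : BlockSensitivityLE f K)
    (hcert : ∀ X, ∃ C : Finset (Fin N), C.card ≤ M ∧ ∀ Y, (∀ i ∈ C, Y i = X i) → f Y = f X)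
    (r : ℕ) (P : Set (Fin N → Bool)) (S : Finset (Fin N))
    (hP : ∀ Y ∈ P, ∀ Z ∈ P, ∀ i ∈ S, Y i = Z i)
    (hblocks : ∀ Y ∈ P, f Y = false → ∃ F : Finset (Finset (Fin N)),
      (F : Set (Finset (Fin N))).PairwiseDisjoint id ∧
      (∀ B ∈ F, B ⊆ S ∧ f (flipBlock Y B) ≠ f Y) ∧ K < F.card + r) :
    Solvable f (r * M) P := by
  induction r generalizing P S with
  | zero =>
    refine solvable_of_forall_eq _ true fun Y hY => ?_
    by_contra hfY
    obtain ⟨F, hF, hFB, hK⟩ := hblocks Y hY (by simpa using hfY)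
    have := hf Y F hF fun B hB => (hFB B hB).2
    omega
  | succ r ih =>
    by_cases hZ : ∃ Z ∈ P, f Z = true
    swap
    · exact solvable_of_forall_eq _ false fun Y hY => by simpa using fun h => hZ ⟨Y, hY, h⟩
    obtain ⟨Z, hZP, hfZ⟩ := hZ
    obtain ⟨C, hCM, hC⟩ := hcert Z
    have hquery : Solvable f (C.card + r * M) P := by
      refine Solvable.query _ C P fun ρ => ih _ (S ∪ C) ?_ ?_
      · rintro Y ⟨hY, hYρ⟩ Y' ⟨hY', hYρ'⟩ i hi
        obtain hi | hi := Finset.mem_union.1 hi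
        · exact hP Y hY Y' hY' i hi
        · rw [hYρ i hi, hYρ' i hi]
      · rintro Y ⟨hY, -⟩ hfY
        obtain ⟨F, hF, hFB, hK⟩ := hblocks Y hY hfY
        set B : Finset (Fin N) := {i ∈ C | Z i ≠ Y i}
        have hBsens : f (flipBlock Y B) ≠ f Y := by
          rw [hC _ fun i hi => flipBlock_filter_ne Y Z C hi, hfZ, hfY]
          simp
        have hBS : Disjoint B S := Finset.disjoint_left.2 fun i hi hiS =>
          (Finset.mem_filter.1 hi).2 (hP Z hZP Y hY i hiS)
        have hBF : B ∉ F := fun h => by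
          have : B = ∅ := disjoint_self.1 (hBS.mono_right (hFB B h).1)
          exact hBsens (by rw [this, flipBlock_empty])
        refine ⟨insert B F, ?_, fun B' hB' => ?_, ?_⟩
        · rw [Finset.coe_insert]
          exact hF.insert fun B' hB' _ => hBS.mono_right (hFB B' hB').1
        · obtain rfl | h := Finset.mem_insert.1 hB'
          · exact ⟨(Finset.filter_subset _ _).trans Finset.subset_union_right, hBsens⟩
          · exact ⟨(hFB B' h).1.trans Finset.subset_union_left, (hFB B' h).2⟩
        · rw [Finset.card_insert_of_notMem hBF]
          omega
    obtain ⟨T, hT, hTf⟩ := hquery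
    exact ⟨T, hT.trans (by rw [Nat.succ_mul]; omega), hTf⟩

theorem exists_depth_le_of_blockSensitivityLE {K : ℕ} (hf : BlockSensitivityLE f K) :
    ∃ T : DTree N, T.depth ≤ (K + 1) * (K * K) ∧ ∀ X, T.evalT X = f X := by
  obtain ⟨T, hT, hTf⟩ := solvable_of_blocks hf hf.exists_certificate (K + 1) Set.univ ∅
    (by simp) fun Y _ _ => ⟨∅, by simp⟩
  exact ⟨T, hT, fun X => hTf X trivial⟩

theorem exists_mvPolynomial_eval_eq (T : DTree N) :
    ∃ p : MvPolynomial (Fin N) ℝ, p.totalDegree ≤ T.depth ∧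
      ∀ X : Fin N → Bool, p.eval (fun i => bR (X i)) = bR (T.evalT X) := by
  induction T with
  | leaf b => exact ⟨MvPolynomial.C (bR b), by simp, fun X => by simp [evalT]⟩
  | node i t₀ t₁ ih₀ ih₁ =>
    obtain ⟨p₀, hd₀, hp₀⟩ := ih₀
    obtain ⟨p₁, hd₁, hp₁⟩ := ih₁
    refine ⟨p₀ + MvPolynomial.X i * (p₁ - p₀), ?_, fun X => ?_⟩
    · have h₁ := MvPolynomial.totalDegree_add p₀ (MvPolynomial.X i * (p₁ - p₀))
      have h₂ := MvPolynomial.totalDegree_mul (MvPolynomial.X i) (p₁ - p₀)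
      have h₃ := MvPolynomial.totalDegree_sub p₁ p₀
      rw [MvPolynomial.totalDegree_X] at h₂
      simp only [depth]
      omega
    · simp only [map_add, map_mul, map_sub, MvPolynomial.eval_X, hp₀, hp₁, evalT]
      cases X i <;> simp [bR]

end DTree

/-- `adeg(f) ≤ D(f) ≤ 216 · adeg(f)⁶`: (i) for every polynomial `p`
approximating `f`, there is a decision tree of depth at most `216 · (deg p)⁶`
computing `f`; (ii) for every decision tree `T` computing `f`, there is an
approximating (in fact representing) polynomial of degree at most `depth T`. -/
theorem D_le_approx_degree_six (N : ℕ) (f : (Fin N → Bool) → Bool) :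
    (∀ p : MvPolynomial (Fin N) ℝ,
      (∀ X : Fin N → Bool,
        |MvPolynomial.eval (fun i => bR (X i)) p - bR (f X)| ≤ 1 / 3) →
      ∃ T : DTree N, T.depth ≤ 216 * p.totalDegree ^ 6 ∧
        ∀ X : Fin N → Bool, T.evalT X = f X) ∧
    (∀ T : DTree N, (∀ X : Fin N → Bool, T.evalT X = f X) →
      ∃ p : MvPolynomial (Fin N) ℝ, p.totalDegree ≤ T.depth ∧
        ∀ X : Fin N → Bool,
          |MvPolynomial.eval (fun i => bR (X i)) p - bR (f X)| ≤ 1 / 3) := by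
  refine ⟨fun p hp => ?_, fun T hT => ?_⟩
  · obtain ⟨T, hT, hTf⟩ :=
      DTree.exists_depth_le_of_blockSensitivityLE (blockSensitivityLE_of_approx hp)
    refine ⟨T, hT.trans ?_, hTf⟩
    have : p.totalDegree ^ 4 ≤ p.totalDegree ^ 6 := by
      rcases Nat.eq_zero_or_pos p.totalDegree with h | h
      · simp [h]
      · exact Nat.pow_le_pow_right h (by norm_num)
    nlinarith
  · obtain ⟨p, hd, hp⟩ := T.exists_mvPolynomial_eval_eq
    exact ⟨p, hd, fun X => by simp [hp X, hT X]⟩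
end

section
/- Any real polynomial q : ℝ^b → ℝ with q(Y) ∈ [0,1] for all Y ∈ {0,1}^b, q(0,...,0) ≤ 1/3, and q(e_i) ≥ 2/3 for all i (where e_i is the i-th standard basis vector), has degree at least sqrt(b/4). -/
/-- Markov's inequality at the left endpoint of `[0,1]`. -/
theorem coeff_one_le_sq_of_mem_Icc {n : ℕ} {r : Polynomial ℝ} (hdeg : r.natDegree ≤ n)
    (hr : ∀ p ∈ Set.Icc (0 : ℝ) 1, r.eval p ∈ Set.Icc (0 : ℝ) 1) :
    r.coeff 1 ≤ (n : ℝ) ^ 2 := by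
  open Polynomial in
  set P : ℝ[X] := 1 - C 2 * r.comp (C (1 / 2) - C (1 / 2) * X) with hP
  have hPdeg : P.degree ≤ n := by
    refine natDegree_le_iff_degree_le.mp ?_
    have hlin : (C (1 / 2 : ℝ) - C (1 / 2) * X).natDegree ≤ 1 := by compute_degree
    have hcomp : (r.comp (C (1 / 2 : ℝ) - C (1 / 2) * X)).natDegree ≤ n :=
      natDegree_comp_le.trans ((Nat.mul_le_mul hdeg hlin).trans_eq (mul_one n))
    refine (natDegree_sub_le _ _).trans (max_le (by simp) ?_)
    exact (natDegree_C_mul_le _ _).trans hcomp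
  have hPbnd : ∀ x ∈ Set.Icc (-1 : ℝ) 1, |P.eval x| ≤ 1 := by
    intro x hx
    obtain ⟨h0, h1⟩ := hr (1 / 2 - 1 / 2 * x) ⟨by linarith [hx.2], by linarith [hx.1]⟩
    simp only [hP, eval_sub, eval_one, eval_mul, eval_C, eval_comp, eval_X]
    rw [abs_le]
    constructor <;> linarith
  have hmarkov := Chebyshev.eval_iterate_derivative_le_of_forall_abs_le_one (k := 1) le_rfl
    hPdeg hPbnd
  have hderiv : (derivative P).eval 1 = r.coeff 1 := by
    simp [hP, derivative_comp, ← coeff_zero_eq_eval_zero, coeff_derivative]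
  have hT : (derivative (Chebyshev.T ℝ n)).eval 1 = (n : ℝ) ^ 2 := by
    simp [Chebyshev.T_derivative_eq_U, sq]
  simpa [hderiv, hT] using hmarkov

/-- The expectation of `q` at a vector of independent Bernoulli variables of parameter `X`. -/
noncomputable def bernoulliPolynomial {b : ℕ} (q : MvPolynomial (Fin b) ℝ) : Polynomial ℝ :=
  ∑ s ∈ q.support, Polynomial.C (q.coeff s) * Polynomial.X ^ s.support.card

theorem natDegree_bernoulliPolynomial_le {b : ℕ} (q : MvPolynomial (Fin b) ℝ) :
    (bernoulliPolynomial q).natDegree ≤ q.totalDegree := by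
  refine Polynomial.natDegree_sum_le_of_forall_le _ _ fun s hs => ?_
  refine (Polynomial.natDegree_C_mul_X_pow_le _ _).trans
    (le_trans ?_ (MvPolynomial.le_totalDegree hs))
  rw [Finset.card_eq_sum_ones]
  exact Finset.sum_le_sum fun i hi => Nat.one_le_iff_ne_zero.mpr (Finsupp.mem_support_iff.mp hi)

theorem sum_prod_bernoulli_eq_one {b : ℕ} (p : ℝ) :
    ∑ Y : Fin b → Bool, ∏ i, (if Y i then p else 1 - p) = 1 := by
  rw [← Fintype.prod_sum (fun (_ : Fin b) (y : Bool) => if y then p else 1 - p)]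
  simp

theorem sum_prod_bernoulli_mul_monomial {b : ℕ} (p : ℝ) (s : Fin b →₀ ℕ) :
    ∑ Y : Fin b → Bool, (∏ i, (if Y i then p else 1 - p)) * ∏ i, bR (Y i) ^ s i
      = p ^ s.support.card := by
  simp_rw [← Finset.prod_mul_distrib]
  rw [← Fintype.prod_sum (fun (i : Fin b) (y : Bool) => (if y then p else 1 - p) * bR y ^ s i),
    ← Finset.prod_const, ← Finset.prod_subset (Finset.subset_univ s.support)]
  · refine Finset.prod_congr rfl fun i hi => ?_
    simp [bR, Finsupp.mem_support_iff.mp hi]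
  · intro i _ hi
    simp [bR, Finsupp.notMem_support_iff.mp hi]

theorem eval_bernoulliPolynomial {b : ℕ} (q : MvPolynomial (Fin b) ℝ) (p : ℝ) :
    (bernoulliPolynomial q).eval p = ∑ Y : Fin b → Bool,
      (∏ i, (if Y i then p else 1 - p)) * MvPolynomial.eval (fun i => bR (Y i)) q := by
  simp_rw [MvPolynomial.eval_eq', Finset.mul_sum]
  rw [Finset.sum_comm, bernoulliPolynomial, Polynomial.eval_finsetSum]
  refine Finset.sum_congr rfl fun s _ => ?_
  simp_rw [mul_left_comm _ (q.coeff s), ← Finset.mul_sum, sum_prod_bernoulli_mul_monomial]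
  simp

theorem eval_bernoulliPolynomial_mem_Icc {b : ℕ} {q : MvPolynomial (Fin b) ℝ}
    (hrange : ∀ Y : Fin b → Bool,
      MvPolynomial.eval (fun i => bR (Y i)) q ∈ Set.Icc (0 : ℝ) 1)
    {p : ℝ} (hp : p ∈ Set.Icc (0 : ℝ) 1) :
    (bernoulliPolynomial q).eval p ∈ Set.Icc (0 : ℝ) 1 := by
  have hweight : ∀ Y : Fin b → Bool, 0 ≤ ∏ i, (if Y i then p else 1 - p) := fun Y =>
    Finset.prod_nonneg fun i _ => by split_ifs <;> linarith [hp.1, hp.2]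
  rw [eval_bernoulliPolynomial]
  refine ⟨Finset.sum_nonneg fun Y _ => mul_nonneg (hweight Y) (hrange Y).1, ?_⟩
  exact (Finset.sum_le_sum fun Y _ => mul_le_of_le_one_right (hweight Y) (hrange Y).2).trans_eq
    (sum_prod_bernoulli_eq_one p)

theorem sum_single_monomial_sub_zero_monomial {b : ℕ} (s : Fin b →₀ ℕ) :
    ∑ i : Fin b, (∏ j, (if j = i then (1 : ℝ) else 0) ^ s j - ∏ j, (0 : ℝ) ^ s j)
      = if s.support.card = 1 then 1 else 0 := by
  have hsingle : ∀ i, ∏ j, (if j = i then (1 : ℝ) else 0) ^ s j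
      = if s.support ⊆ {i} then 1 else 0 := by
    intro i
    split_ifs with h
    · refine Finset.prod_eq_one fun j _ => ?_
      by_cases hj : j = i
      · simp [hj]
      · have : s j = 0 := Finsupp.notMem_support_iff.mp fun hs => hj (by simpa using h hs)
        simp [this]
    · obtain ⟨j, hj, hji⟩ := Finset.not_subset.mp h
      refine Finset.prod_eq_zero (Finset.mem_univ j) ?_
      simp [Finset.notMem_singleton.mp hji, Finsupp.mem_support_iff.mp hj]
  have hzero : ∏ j, (0 : ℝ) ^ s j = if s.support = ∅ then 1 else 0 := by
    split_ifs with h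
    · simp [Finsupp.support_eq_empty.mp h]
    · obtain ⟨j, hj⟩ := Finset.nonempty_iff_ne_empty.mpr h
      exact Finset.prod_eq_zero (Finset.mem_univ j) (zero_pow (Finsupp.mem_support_iff.mp hj))
  have hdiff : ∀ i, ((if s.support ⊆ {i} then 1 else 0) - (if s.support = ∅ then 1 else 0) : ℝ)
      = if s.support = {i} then 1 else 0 := by
    intro i
    rcases Finset.eq_empty_or_nonempty s.support with h | h
    · simp [h, (Finset.singleton_ne_empty i).symm]
    · simp [h.ne_empty, Finset.subset_singleton_iff]
  simp_rw [hsingle, hzero, hdiff]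
  split_ifs with h
  · obtain ⟨k, hk⟩ := Finset.card_eq_one.mp h
    simp [hk]
  · refine Finset.sum_eq_zero fun i _ => if_neg fun hi => h (by simp [hi])

theorem coeff_one_bernoulliPolynomial {b : ℕ} (q : MvPolynomial (Fin b) ℝ) :
    (bernoulliPolynomial q).coeff 1 = ∑ i : Fin b,
      (MvPolynomial.eval (fun j => if j = i then (1 : ℝ) else 0) q
        - MvPolynomial.eval (fun _ => (0 : ℝ)) q) := by
  simp_rw [MvPolynomial.eval_eq', ← Finset.sum_sub_distrib, ← mul_sub]
  rw [Finset.sum_comm, bernoulliPolynomial, Polynomial.finsetSum_coeff]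
  refine Finset.sum_congr rfl fun s _ => ?_
  rw [← Finset.mul_sum, sum_single_monomial_sub_zero_monomial, Polynomial.coeff_C_mul,
    Polynomial.coeff_X_pow]
  simp [eq_comm]

/-- Any real polynomial `q` on `ℝ^b` with values in `[0,1]` on `{0,1}^b`,
`q(0,…,0) ≤ 1/3`, and `q(eᵢ) ≥ 2/3` for every standard basis vector `eᵢ`,
has degree at least `√(b/4)`. -/
theorem onehot_jump_degree_lower_bound (b : ℕ) (q : MvPolynomial (Fin b) ℝ)
    (hrange : ∀ Y : Fin b → Bool,
      MvPolynomial.eval (fun i => bR (Y i)) q ∈ Set.Icc (0 : ℝ) 1)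
    (hzero : MvPolynomial.eval (fun _ => (0 : ℝ)) q ≤ 1 / 3)
    (hone : ∀ i : Fin b, (2 : ℝ) / 3 ≤
      MvPolynomial.eval (fun j => if j = i then (1 : ℝ) else 0) q) :
    Real.sqrt ((b : ℝ) / 4) ≤ q.totalDegree := by
  have hupper := coeff_one_le_sq_of_mem_Icc (natDegree_bernoulliPolynomial_le q)
    fun p hp => eval_bernoulliPolynomial_mem_Icc hrange hp
  have hlower : (b : ℝ) * (1 / 3) ≤ (bernoulliPolynomial q).coeff 1 := by
    rw [coeff_one_bernoulliPolynomial]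
    have hsum := Finset.sum_le_sum (s := Finset.univ) fun (i : Fin b) _ =>
      show (1 / 3 : ℝ) ≤ MvPolynomial.eval (fun j => if j = i then (1 : ℝ) else 0) q
        - MvPolynomial.eval (fun _ => (0 : ℝ)) q by linarith [hone i]
    rwa [Finset.sum_const, Finset.card_univ, Fintype.card_fin, nsmul_eq_mul] at hsum
  have hb : (0 : ℝ) ≤ b := b.cast_nonneg
  exact Real.sqrt_le_iff.mpr ⟨Nat.cast_nonneg _, by linarith⟩
end
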